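/- Let Ω ⊂ ℂ be a bounded Jordan domain with C^∞ smooth boundary and let U be a real-valued C^∞ function on a neighborhood of Ω̄. Then there exists a real-valued C^∞ function φ on ℂ such that φ vanishes identically on bΩ, the normal derivative ∂φ/∂n vanishes identically on bΩ, and the Laplacian Δφ agrees with U to infinite order on bΩ, i.e. Δφ − U and all of its partial derivatives of every order vanish at every point of bΩ. -/

import Mathlib

open Complex MeasureTheory Metric Set Filter
open scoped ENNReal NNReal Topology

noncomputable section

/-- `Ω` is a bounded Jordan domain with `C^∞` smooth boundary: its boundary Jordan
curve is parametrized (counterclockwise) by the 1-periodic `C^∞` map `γ` with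
nonvanishing derivative. -/
structure SmoothJordanDomain (Ω : Set ℂ) (γ : ℝ → ℂ) : Prop where
  isOpen : IsOpen Ω
  bounded : Bornology.IsBounded Ω
  nonempty : Ω.Nonempty
  periodic : Function.Periodic γ 1
  injOn : InjOn γ (Ico 0 1)
  image : γ '' (Icc 0 1) = frontier Ω
  smooth : ContDiff ℝ (⊤ : ℕ∞) γ
  derivNe : ∀ t : ℝ, deriv γ t ≠ 0
  orientation : ∀ z ∈ Ω,
      (2 * Real.pi * I)⁻¹ * ∫ t in (0:ℝ)..1, deriv γ t / (γ t - z) = 1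

/-- The Laplacian of a real-valued function on `ℂ` (as a function of two real
variables). -/
def laplacianR (f : ℂ → ℝ) (z : ℂ) : ℝ :=
  fderiv ℝ (fun w => fderiv ℝ f w 1) z 1 + fderiv ℝ (fun w => fderiv ℝ f w I) z I

/-! ### Flatness calculus -/

/-- All derivatives of order `< m` vanish at `q`. -/
def FlatAt (m : ℕ) (f : ℂ → ℝ) (q : ℂ) : Prop := ∀ j < m, iteratedFDeriv ℝ j f q = 0

lemma natcast_le_top (j : ℕ) : ((j : ℕ∞) : WithTop ℕ∞) ≤ ((⊤ : ℕ∞) : WithTop ℕ∞) := by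
  exact_mod_cast (le_top : (j : ℕ∞) ≤ ⊤)

lemma natcast_le_top' (j : ℕ) : (j : WithTop ℕ∞) ≤ ((⊤ : ℕ∞) : WithTop ℕ∞) := by
  exact_mod_cast (le_top : (j : ℕ∞) ≤ ⊤)

lemma FlatAt.add {m : ℕ} {f g : ℂ → ℝ} {q : ℂ} (hf : ContDiff ℝ (⊤ : ℕ∞) f)
    (hg : ContDiff ℝ (⊤ : ℕ∞) g) (h1 : FlatAt m f q) (h2 : FlatAt m g q) :
    FlatAt m (fun z => f z + g z) q := by
  intro j hj
  rw [fun_iteratedFDeriv_add_apply (hf.contDiffAt.of_le (natcast_le_top' j))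
    (hg.contDiffAt.of_le (natcast_le_top' j)), h1 j hj, h2 j hj, add_zero]

lemma FlatAt.congr {m : ℕ} {f g : ℂ → ℝ} {q : ℂ} (h1 : FlatAt m f q) (h : g =ᶠ[𝓝 q] f) :
    FlatAt m g q := by
  intro j hj
  rw [(h.iteratedFDeriv ℝ j).eq_of_nhds, h1 j hj]

lemma flat_pow_mul {r h : ℂ → ℝ} {q : ℂ} (hr : ContDiff ℝ (⊤ : ℕ∞) r)
    (hh : ContDiff ℝ (⊤ : ℕ∞) h) (hq : r q = 0) (m : ℕ) :
    FlatAt m (fun z => r z ^ m * h z) q := by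
  induction m with
  | zero => intro j hj; omega
  | succ m ih =>
    intro j hj
    have e : (fun z => r z ^ (m + 1) * h z) = fun z => r z * (r z ^ m * h z) := by
      funext z; ring
    rw [e, ← norm_le_zero_iff]
    refine (norm_iteratedFDeriv_mul_le hr ((hr.pow m).mul hh) q (natcast_le_top' j)).trans ?_
    refine (Finset.sum_eq_zero fun i hi => ?_).le
    have hij : i ≤ j := by simpa [Nat.lt_succ_iff] using hi
    rcases Nat.eq_zero_or_pos i with rfl | hi0
    · simp [hq]
    · rw [ih (j - i) (by omega)]; simp

lemma contDiff_d {f : ℂ → ℝ} (hf : ContDiff ℝ (⊤ : ℕ∞) f) (v : ℂ) :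
    ContDiff ℝ (⊤ : ℕ∞) (fun w => fderiv ℝ f w v) :=
  (hf.fderiv_right (by simp)).clm_apply contDiff_const

lemma contDiff_lap {f : ℂ → ℝ} (hf : ContDiff ℝ (⊤ : ℕ∞) f) :
    ContDiff ℝ (⊤ : ℕ∞) (laplacianR f) :=
  (contDiff_d (contDiff_d hf 1) 1).add (contDiff_d (contDiff_d hf I) I)

lemma FlatAt.d {m : ℕ} {f : ℂ → ℝ} {q : ℂ} (hf : ContDiff ℝ (⊤ : ℕ∞) f)
    (h : FlatAt (m + 1) f q) (v : ℂ) : FlatAt m (fun w => fderiv ℝ f w v) q := by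
  intro j hj
  rw [← norm_le_zero_iff]
  have h1 : ContDiff ℝ (⊤ : ℕ∞) (fderiv ℝ f) := hf.fderiv_right (by simp)
  refine (norm_iteratedFDeriv_clm_apply_const h1.contDiffAt (natcast_le_top' j)).trans ?_
  rw [norm_iteratedFDeriv_fderiv, h (j + 1) (by omega)]
  simp

lemma FlatAt.lap {m : ℕ} {f : ℂ → ℝ} {q : ℂ} (hf : ContDiff ℝ (⊤ : ℕ∞) f)
    (h : FlatAt (m + 2) f q) : FlatAt m (laplacianR f) q :=
  FlatAt.add (contDiff_d (contDiff_d hf 1) 1) (contDiff_d (contDiff_d hf I) I)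
    (FlatAt.d (contDiff_d hf 1) (FlatAt.d hf h 1) 1)
    (FlatAt.d (contDiff_d hf I) (FlatAt.d hf h I) I)

/-! ### The Laplacian of `r ^ (k+2) * a` -/

lemma d_mul {f g : ℂ → ℝ} (hf : ContDiff ℝ (⊤ : ℕ∞) f) (hg : ContDiff ℝ (⊤ : ℕ∞) g) (v z : ℂ) :
    fderiv ℝ (fun w => f w * g w) z v = f z * fderiv ℝ g z v + fderiv ℝ f z v * g z := by
  rw [fderiv_fun_mul (hf.differentiable (by simp) z) (hg.differentiable (by simp) z)]
  simp [mul_comm]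

lemma d_add {f g : ℂ → ℝ} (hf : ContDiff ℝ (⊤ : ℕ∞) f) (hg : ContDiff ℝ (⊤ : ℕ∞) g) (v z : ℂ) :
    fderiv ℝ (fun w => f w + g w) z v = fderiv ℝ f z v + fderiv ℝ g z v := by
  rw [fderiv_fun_add (hf.differentiable (by simp) z) (hg.differentiable (by simp) z)]
  simp

lemma d_pow {f : ℂ → ℝ} (hf : ContDiff ℝ (⊤ : ℕ∞) f) (v z : ℂ) (n : ℕ) :
    fderiv ℝ (fun w => f w ^ (n + 1)) z v = (n + 1) * f z ^ n * fderiv ℝ f z v := by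
  induction n with
  | zero => simp
  | succ n ih =>
    have e : (fun w => f w ^ (n + 1 + 1)) = fun w => f w ^ (n + 1) * f w := by
      funext w; ring
    rw [e, d_mul (hf.pow _) hf, ih]; push_cast; ring

lemma d_const {c : ℝ} (v z : ℂ) : fderiv ℝ (fun _ : ℂ => c) z v = 0 := by simp

lemma dd_formula {r a : ℂ → ℝ} (hr : ContDiff ℝ (⊤ : ℕ∞) r) (ha : ContDiff ℝ (⊤ : ℕ∞) a)
    (k : ℕ) (v z : ℂ) :
    fderiv ℝ (fun w => fderiv ℝ (fun u => r u ^ (k + 2) * a u) w v) z v =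
      ((k : ℝ) + 2) * (k + 1) * r z ^ k * (fderiv ℝ r z v) ^ 2 * a z
      + r z ^ (k + 1) * (2 * (k + 2) * (fderiv ℝ r z v * fderiv ℝ a z v)
          + (k + 2) * a z * fderiv ℝ (fun w => fderiv ℝ r w v) z v)
      + r z ^ (k + 2) * fderiv ℝ (fun w => fderiv ℝ a w v) z v := by
  have hdr := contDiff_d hr v
  have hda := contDiff_d ha v
  have e : (fun w => fderiv ℝ (fun u => r u ^ (k + 2) * a u) w v) =
      fun w => r w ^ (k + 1 + 1) * fderiv ℝ a w v
        + ((k + 2 : ℝ) * r w ^ (k + 1)) * (fderiv ℝ r w v * a w) := by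
    funext w
    rw [d_mul (hr.pow _) ha, show k + 2 = (k + 1) + 1 from rfl, d_pow hr]
    push_cast; ring
  have hp : ContDiff ℝ (⊤ : ℕ∞) (fun w => (k + 2 : ℝ) * r w ^ (k + 1)) :=
    contDiff_const.mul (hr.pow _)
  rw [e, d_add ((hr.pow _).mul hda) (hp.mul (hdr.mul ha)), d_mul (hr.pow _) hda, d_pow hr,
    d_mul hp (hdr.mul ha), d_mul hdr ha, d_mul contDiff_const (hr.pow _), d_const, d_pow hr]
  push_cast; ring

lemma lap_formula {r a : ℂ → ℝ} (hr : ContDiff ℝ (⊤ : ℕ∞) r) (ha : ContDiff ℝ (⊤ : ℕ∞) a)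
    (k : ℕ) (z : ℂ) :
    laplacianR (fun u => r u ^ (k + 2) * a u) z =
      r z ^ k * (((k : ℝ) + 2) * (k + 1) * ((fderiv ℝ r z 1) ^ 2 + (fderiv ℝ r z I) ^ 2) * a z)
      + r z ^ (k + 1) * (2 * (k + 2) * (fderiv ℝ r z 1 * fderiv ℝ a z 1
          + fderiv ℝ r z I * fderiv ℝ a z I)
          + (k + 2) * a z * laplacianR r z + r z * laplacianR a z) := by
  unfold laplacianR
  rw [dd_formula hr ha, dd_formula hr ha]
  ring

/-- The coefficient. -/
def aOf (g h : ℂ → ℝ) (k : ℕ) : ℂ → ℝ := fun z => g z * (-(((k : ℝ) + 2) * (k + 1))⁻¹ * h z)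

/-- The remainders. -/
def hseq (r g u : ℂ → ℝ) : ℕ → ℂ → ℝ
  | 0 => fun z => - u z
  | k + 1 => fun z => 2 * ((k : ℝ) + 2) * (fderiv ℝ r z 1 * fderiv ℝ (aOf g (hseq r g u k) k) z 1
          + fderiv ℝ r z I * fderiv ℝ (aOf g (hseq r g u k) k) z I)
          + (k + 2) * (aOf g (hseq r g u k) k) z * laplacianR r z
          + r z * laplacianR (aOf g (hseq r g u k) k) z

lemma contDiff_aOf {g h : ℂ → ℝ} (hg : ContDiff ℝ (⊤ : ℕ∞) g) (hh : ContDiff ℝ (⊤ : ℕ∞) h)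
    (k : ℕ) : ContDiff ℝ (⊤ : ℕ∞) (aOf g h k) :=
  hg.mul (contDiff_const.mul hh)

lemma contDiff_hseq {r g u : ℂ → ℝ} (hr : ContDiff ℝ (⊤ : ℕ∞) r) (hg : ContDiff ℝ (⊤ : ℕ∞) g)
    (hu : ContDiff ℝ (⊤ : ℕ∞) u) (k : ℕ) : ContDiff ℝ (⊤ : ℕ∞) (hseq r g u k) := by
  induction k with
  | zero => exact hu.neg
  | succ k ih =>
    have ha := contDiff_aOf hg ih k
    exact ((contDiff_const.mul (((contDiff_d hr 1).mul (contDiff_d ha 1)).add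
      ((contDiff_d hr I).mul (contDiff_d ha I)))).add
      ((contDiff_const.mul ha).mul (contDiff_lap hr))).add (hr.mul (contDiff_lap ha))

lemma lap_step {r g u : ℂ → ℝ} (hr : ContDiff ℝ (⊤ : ℕ∞) r) (hg : ContDiff ℝ (⊤ : ℕ∞) g)
    (hu : ContDiff ℝ (⊤ : ℕ∞) u) (k : ℕ) (z : ℂ)
    (hz : g z * ((fderiv ℝ r z 1) ^ 2 + (fderiv ℝ r z I) ^ 2) = 1) :
    laplacianR (fun w => r w ^ (k + 2) * aOf g (hseq r g u k) k w) z =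
      r z ^ (k + 1) * hseq r g u (k + 1) z - r z ^ k * hseq r g u k z := by
  rw [lap_formula hr (contDiff_aOf hg (contDiff_hseq hr hg hu k) k)]
  have e : ((k : ℝ) + 2) * (k + 1) * ((fderiv ℝ r z 1) ^ 2 + (fderiv ℝ r z I) ^ 2)
      * aOf g (hseq r g u k) k z = - hseq r g u k z := by
    have h2 : ((k : ℝ) + 2) * (k + 1) ≠ 0 := by positivity
    unfold aOf
    calc _ = - ((((k : ℝ) + 2) * (k + 1)) * (((k : ℝ) + 2) * (k + 1))⁻¹)
        * (g z * ((fderiv ℝ r z 1) ^ 2 + (fderiv ℝ r z I) ^ 2)) * hseq r g u k z := by ring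
      _ = _ := by rw [hz, mul_inv_cancel₀ h2]; ring
  rw [e, hseq]
  ring

lemma lap_add {f g : ℂ → ℝ} (hf : ContDiff ℝ (⊤ : ℕ∞) f) (hg : ContDiff ℝ (⊤ : ℕ∞) g) (z : ℂ) :
    laplacianR (fun w => f w + g w) z = laplacianR f z + laplacianR g z := by
  unfold laplacianR
  have e (v : ℂ) : (fun w => fderiv ℝ (fun w => f w + g w) w v) =
      fun w => fderiv ℝ f w v + fderiv ℝ g w v := by
    funext w; exact d_add hf hg v w
  rw [e, e, d_add (contDiff_d hf 1) (contDiff_d hg 1), d_add (contDiff_d hf I) (contDiff_d hg I)]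
  ring

lemma lap_congr {f g : ℂ → ℝ} {z : ℂ} (h : f =ᶠ[𝓝 z] g) : laplacianR f =ᶠ[𝓝 z] laplacianR g := by
  have e (v : ℂ) : (fun w => fderiv ℝ (fun w => fderiv ℝ f w v) w v) =ᶠ[𝓝 z]
      fun w => fderiv ℝ (fun w => fderiv ℝ g w v) w v := by
    have h1 : (fun w => fderiv ℝ f w v) =ᶠ[𝓝 z] fun w => fderiv ℝ g w v := by
      filter_upwards [h.fderiv (𝕜 := ℝ)] with w hw; rw [hw]
    filter_upwards [h1.fderiv (𝕜 := ℝ)] with w hw; rw [hw]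
  filter_upwards [e 1, e I] with w h1 h2
  unfold laplacianR
  rw [h1, h2]

lemma lap_partial {r g u : ℂ → ℝ} (hr : ContDiff ℝ (⊤ : ℕ∞) r) (hg : ContDiff ℝ (⊤ : ℕ∞) g)
    (hu : ContDiff ℝ (⊤ : ℕ∞) u) (q : ℂ)
    (hz : ∀ᶠ z in 𝓝 q, g z * ((fderiv ℝ r z 1) ^ 2 + (fderiv ℝ r z I) ^ 2) = 1)
    (b : ℕ → ℂ → ℝ) (hb : ∀ k, ContDiff ℝ (⊤ : ℕ∞) (b k))
    (hbq : ∀ k, b k =ᶠ[𝓝 q] fun z => r z ^ (k + 2) * aOf g (hseq r g u k) k z) (N : ℕ) :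
    laplacianR (fun z => ∑ k ∈ Finset.range N, b k z) =ᶠ[𝓝 q]
      fun z => r z ^ N * hseq r g u N z + u z := by
  induction N with
  | zero =>
    refine Eventually.of_forall fun z => ?_
    simp [laplacianR, hseq]
  | succ N ih =>
    filter_upwards [ih, lap_congr (hbq N), hz] with z h1 h2 h3
    simp_rw [Finset.sum_range_succ]
    rw [lap_add (ContDiff.sum fun k _ => hb k) (hb N), h1, h2, lap_step hr hg hu N z h3]
    ring

/-! ### Borel summation -/

lemma bdd_derivs {E : Type*} [NormedAddCommGroup E] [NormedSpace ℝ E] {f : E → ℝ}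
    (hf : ContDiff ℝ (⊤ : ℕ∞) f) (hc : HasCompactSupport f) (n : ℕ) :
    ∃ C : ℝ, 1 ≤ C ∧ ∀ j ≤ n, ∀ x, ‖iteratedFDeriv ℝ j f x‖ ≤ C := by
  induction n with
  | zero =>
    obtain ⟨C, hC⟩ := (hc.iteratedFDeriv (𝕜 := ℝ) 0).exists_bound_of_continuous
      (hf.continuous_iteratedFDeriv (natcast_le_top' 0))
    refine ⟨max 1 C, le_max_left _ _, fun j hj x => ?_⟩
    obtain rfl : j = 0 := by omega
    exact (hC x).trans (le_max_right _ _)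
  | succ n ih =>
    obtain ⟨D, hD1, hD⟩ := ih
    obtain ⟨C, hC⟩ := (hc.iteratedFDeriv (𝕜 := ℝ) (n + 1)).exists_bound_of_continuous
      (hf.continuous_iteratedFDeriv (natcast_le_top' (n + 1)))
    refine ⟨max D C, hD1.trans (le_max_left _ _), fun j hj x => ?_⟩
    rcases Nat.lt_or_ge n j with h | h
    · obtain rfl : j = n + 1 := by omega
      exact (hC x).trans (le_max_right _ _)
    · exact (hD j h x).trans (le_max_left _ _)

lemma borel_term {r a : ℂ → ℝ} (hr : ContDiff ℝ (⊤ : ℕ∞) r) (hrc : HasCompactSupport r)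
    (ha : ContDiff ℝ (⊤ : ℕ∞) a) (hac : HasCompactSupport a) (k : ℕ) {ε : ℝ} (hε : 0 < ε) :
    ∃ b : ℂ → ℝ, ContDiff ℝ (⊤ : ℕ∞) b ∧
      (∀ q, r q = 0 → b =ᶠ[𝓝 q] fun z => r z ^ (k + 2) * a z) ∧
      ∀ j ≤ k + 1, ∀ x, ‖iteratedFDeriv ℝ j b x‖ ≤ ε := by
  let χ : ContDiffBump (0 : ℝ) := ⟨1, 2, by norm_num, by norm_num⟩
  let ψ : ℝ → ℝ := fun s => s ^ (k + 2) * χ s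
  have hψ : ContDiff ℝ (⊤ : ℕ∞) ψ := (contDiff_id.pow _).mul χ.contDiff
  have hψc : HasCompactSupport ψ := χ.hasCompactSupport.mul_left
  obtain ⟨C, hC1, hC⟩ := bdd_derivs hψ hψc (k + 1)
  obtain ⟨M, hM1, hM⟩ := bdd_derivs hr hrc (k + 1)
  obtain ⟨A, hA1, hA⟩ := bdd_derivs ha hac (k + 1)
  set B : ℝ := ((k + 1).factorial : ℝ) * C * M ^ (k + 1) with hB
  have hB0 : 0 ≤ B := by positivity
  set L : ℝ := max 1 (2 ^ (k + 1) * A * B / ε) with hL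
  have hL1 : 1 ≤ L := le_max_left _ _
  have hL0 : 0 < L := by linarith
  have hLr : ContDiff ℝ (⊤ : ℕ∞) (fun z => L * r z) := contDiff_const.mul hr
  have hg : ContDiff ℝ (⊤ : ℕ∞) (ψ ∘ fun z => L * r z) := hψ.comp hLr
  have hgb : ∀ j ≤ k + 1, ∀ x, ‖iteratedFDeriv ℝ j (ψ ∘ fun z => L * r z) x‖
      ≤ B * L ^ (k + 1) := by
    intro j hj x
    have h1 : ∀ i, 1 ≤ i → i ≤ j → ‖iteratedFDeriv ℝ i (fun z => L * r z) x‖ ≤ (L * M) ^ i := by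
      intro i hi hij
      have e : iteratedFDeriv ℝ i (fun z => L * r z) x = L • iteratedFDeriv ℝ i r x :=
        iteratedFDeriv_const_smul_apply' (a := L)
          (hr.contDiffAt.of_le (natcast_le_top' i))
      rw [e, norm_smul, Real.norm_of_nonneg hL0.le]
      have hLM : 1 ≤ L * M := one_le_mul_of_one_le_of_one_le hL1 hM1
      calc L * ‖iteratedFDeriv ℝ i r x‖ ≤ L * M := by
            gcongr; exact hM i (by omega) x
        _ ≤ (L * M) ^ i := le_self_pow₀ hLM (by omega)
    refine (norm_iteratedFDeriv_comp_le hψ hLr (natcast_le_top' j) x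
      (fun i hi => hC i (by omega) _) h1).trans ?_
    calc (j.factorial : ℝ) * C * (L * M) ^ j
        ≤ ((k + 1).factorial : ℝ) * C * (L * M) ^ (k + 1) := by
          gcongr
          exact one_le_mul_of_one_le_of_one_le hL1 hM1
      _ = B * L ^ (k + 1) := by rw [hB]; ring
  have hag : ContDiff ℝ (⊤ : ℕ∞) (fun z => a z * (ψ ∘ fun z => L * r z) z) := ha.mul hg
  refine ⟨fun z => (L ^ (k + 2))⁻¹ • (a z * (ψ ∘ fun z => L * r z) z),
    hag.const_smul _, ?_, ?_⟩
  · intro q hq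
    have h1 : ∀ᶠ z in 𝓝 q, χ (L * r z) = 1 := by
      have h2 : χ =ᶠ[𝓝 (L * r q)] 1 := by
        rw [hq, mul_zero]; exact χ.eventuallyEq_one
      exact hLr.continuous.continuousAt.eventually h2
    filter_upwards [h1] with z hz
    simp only [Function.comp, ψ, hz, smul_eq_mul]
    have : L ^ (k + 2) ≠ 0 := by positivity
    field_simp
    ring
  · intro j hj x
    rw [iteratedFDeriv_const_smul_apply' (hag.contDiffAt.of_le (natcast_le_top' j)), norm_smul]
    have h1 : ‖iteratedFDeriv ℝ j (fun z => a z * (ψ ∘ fun z => L * r z) z) x‖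
        ≤ 2 ^ (k + 1) * A * B * L ^ (k + 1) := by
      refine (norm_iteratedFDeriv_mul_le ha hg x (natcast_le_top' j)).trans ?_
      calc _ ≤ ∑ i ∈ Finset.range (j + 1), (j.choose i : ℝ) * A * (B * L ^ (k + 1)) := by
            refine Finset.sum_le_sum fun i hi => ?_
            have : i ≤ j := by simpa [Nat.lt_succ_iff] using hi
            gcongr
            · exact hA i (by omega) x
            · exact hgb (j - i) (by omega) x
        _ = 2 ^ j * A * B * L ^ (k + 1) := by
            rw [← Finset.sum_mul, ← Finset.sum_mul]
            have := Nat.sum_range_choose j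
            have h3 : ∑ i ∈ Finset.range (j + 1), (j.choose i : ℝ) = 2 ^ j := by exact_mod_cast this
            rw [h3]; ring
        _ ≤ _ := by
            gcongr
            · norm_num
    have h2 : 2 ^ (k + 1) * A * B ≤ ε * L := by
      have := le_max_right 1 (2 ^ (k + 1) * A * B / ε)
      rw [← hL, div_le_iff₀ hε] at this
      linarith
    rw [Real.norm_of_nonneg (by positivity), inv_mul_le_iff₀ (by positivity)]
    calc _ ≤ 2 ^ (k + 1) * A * B * L ^ (k + 1) := h1
      _ ≤ ε * L * L ^ (k + 1) := by gcongr
      _ = _ := by ring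

lemma flat_tail {b : ℕ → ℂ → ℝ} (hb : ∀ k, ContDiff ℝ (⊤ : ℕ∞) (b k))
    (hbb : ∀ k, ∀ j ≤ k + 1, ∀ x, ‖iteratedFDeriv ℝ j (b k) x‖ ≤ (1 / 2 : ℝ) ^ k) (N : ℕ) :
    ContDiff ℝ ((N + 1 : ℕ) : ℕ∞) (fun z => ∑' k, b (k + N) z) ∧
    ∀ q, (∀ k, FlatAt (k + 2) (b k) q) → FlatAt (N + 2) (fun z => ∑' k, b (k + N) z) q := by
  have hs : Summable (fun k : ℕ => (1 / 2 : ℝ) ^ (k + N)) :=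
    (summable_nat_add_iff N).2 summable_geometric_two
  have hb' : ∀ k, ContDiff ℝ ((N + 1 : ℕ) : ℕ∞) (b (k + N)) :=
    fun k => (hb _).of_le (natcast_le_top _)
  have hv : ∀ k : ℕ, (k : ℕ∞) ≤ ((N + 1 : ℕ) : ℕ∞) →
    Summable ((fun _ i => (1 / 2 : ℝ) ^ (i + N)) k : ℕ → ℝ) := fun _ _ => hs
  have hbd : ∀ (k i : ℕ) (x : ℂ), (k : ℕ∞) ≤ ((N + 1 : ℕ) : ℕ∞) →
      ‖iteratedFDeriv ℝ k (b (i + N)) x‖ ≤ (fun _ i => (1 / 2 : ℝ) ^ (i + N) : ℕ → ℕ → ℝ) k i := by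
    intro k i x hk
    have : k ≤ N + 1 := by exact_mod_cast hk
    exact hbb (i + N) k (by omega) x
  refine ⟨contDiff_tsum hb' hv hbd, fun q hq j hj => ?_⟩
  have hj' : (j : ℕ∞) ≤ ((N + 1 : ℕ) : ℕ∞) := by exact_mod_cast (by omega : j ≤ N + 1)
  rw [iteratedFDeriv_tsum_apply hb' hv hbd hj' q]
  have : ∀ n, iteratedFDeriv ℝ j (b (n + N)) q = 0 := fun n => hq (n + N) j (by omega)
  simp [this]

/-! ### Cutoffs -/

lemma cutoff_mul {χ f : ℂ → ℝ} {W : Set ℂ} (hW : IsOpen W) (hf : ContDiffOn ℝ (⊤ : ℕ∞) f W)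
    (hχ : ContDiff ℝ (⊤ : ℕ∞) χ) (hs : tsupport χ ⊆ W) :
    ContDiff ℝ (⊤ : ℕ∞) (fun z => χ z * f z) := by
  rw [contDiff_iff_contDiffAt]
  intro z
  by_cases hz : z ∈ tsupport χ
  · exact hχ.contDiffAt.mul (hf.contDiffAt (hW.mem_nhds (hs hz)))
  · have : (fun z => χ z * f z) =ᶠ[𝓝 z] fun _ => 0 := by
      filter_upwards [(isClosed_tsupport χ).isOpen_compl.mem_nhds hz] with w hw
      rw [image_eq_zero_of_notMem_tsupport hw, zero_mul]
    exact contDiffAt_const.congr_of_eventuallyEq this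

lemma cutoff_ext {f : ℂ → ℝ} {W K : Set ℂ} (hW : IsOpen W) (hK : IsCompact K) (hKW : K ⊆ W)
    (hf : ContDiffOn ℝ (⊤ : ℕ∞) f W) :
    ∃ g : ℂ → ℝ, ContDiff ℝ (⊤ : ℕ∞) g ∧ HasCompactSupport g ∧
      ∀ q ∈ K, ∀ᶠ z in 𝓝 q, g z = f z := by
  obtain ⟨R, hR⟩ := hK.isBounded.subset_ball 0
  obtain ⟨χ, h0, h1, -⟩ := exists_contMDiffMap_zero_one_nhds_of_isClosed (n := ⊤)
    (modelWithCornersSelf ℝ ℂ) (s := (W ∩ ball 0 R)ᶜ) (t := K)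
    (hW.inter isOpen_ball).isClosed_compl hK.isClosed
    (disjoint_compl_left_iff_subset.2 (subset_inter hKW hR))
  have hχ : ContDiff ℝ (⊤ : ℕ∞) (χ : ℂ → ℝ) := χ.contMDiff.contDiff
  have hts : tsupport (χ : ℂ → ℝ) ⊆ W ∩ ball 0 R := by
    intro z hz
    by_contra hzn
    have h2 : ∀ᶠ w in 𝓝 z, χ w = 0 := (eventually_nhdsSet_iff_forall.1 h0) z hzn
    exact (notMem_tsupport_iff_eventuallyEq.2 h2) hz
  refine ⟨fun z => χ z * f z, cutoff_mul hW hf hχ (hts.trans inter_subset_left), ?_, ?_⟩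
  · have : HasCompactSupport (χ : ℂ → ℝ) :=
      (isCompact_closedBall (0 : ℂ) R).of_isClosed_subset (isClosed_tsupport _)
        (hts.trans (inter_subset_right.trans ball_subset_closedBall))
    exact this.mul_right
  · intro q hq
    filter_upwards [(eventually_nhdsSet_iff_forall.1 h1) q hq] with z hz
    rw [hz, one_mul]

/-! ### A defining function for the boundary curve -/

lemma per_int {α : Type*} {γ : ℝ → α} (hp : Function.Periodic γ 1) (t : ℝ) (m : ℤ) :
    γ (t + m) = γ t := by
  simpa using hp.int_mul m t

lemma deriv_per {γ : ℝ → ℂ} (hp : Function.Periodic γ 1) : Function.Periodic (deriv γ) 1 := by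
  intro t
  rw [← deriv_comp_add_const]
  congr 1
  funext x
  exact hp x

lemma curve_inj {γ : ℝ → ℂ} (hp : Function.Periodic γ 1) (hi : InjOn γ (Ico 0 1)) {t s : ℝ}
    (h : γ t = γ s) : ∃ m : ℤ, t + m = s := by
  have h1 : ∀ u : ℝ, γ (Int.fract u) = γ u := fun u => by
    have := per_int hp u (-⌊u⌋)
    rw [← this]; congr 1
    rw [Int.fract]; push_cast; ring
  have h2 : Int.fract t = Int.fract s :=
    hi ⟨Int.fract_nonneg _, Int.fract_lt_one _⟩ ⟨Int.fract_nonneg _, Int.fract_lt_one _⟩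
      (by rw [h1, h1, h])
  refine ⟨⌊s⌋ - ⌊t⌋, ?_⟩
  rw [Int.fract, Int.fract] at h2
  push_cast
  linarith

lemma local_param {γ : ℝ → ℂ} (hp : Function.Periodic γ 1) (hi : InjOn γ (Ico 0 1))
    (hc : Continuous γ) (t₀ : ℝ) {J : Set ℝ} (hJ : J ∈ 𝓝 t₀) :
    ∀ᶠ z in 𝓝 (γ t₀), ∀ t, γ t = z → ∃ m : ℤ, t + m ∈ J := by
  set K : Set ℝ := Icc (t₀ - 1 / 2) (t₀ + 1 / 2) ∩ (interior J)ᶜ with hK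
  have hKc : IsCompact K := isCompact_Icc.inter_right isOpen_interior.isClosed_compl
  have hn : γ t₀ ∉ γ '' K := by
    rintro ⟨s, ⟨⟨hs1, hs2⟩, hs3⟩, hs⟩
    obtain ⟨m, hm⟩ := curve_inj hp hi hs
    have h1 : |(m : ℝ)| < 1 := by rw [abs_lt]; constructor <;> linarith
    have h2 : m = 0 := by
      have : |m| < 1 := by exact_mod_cast h1
      exact Int.abs_lt_one_iff.1 this
    rw [h2, Int.cast_zero, add_zero] at hm
    rw [hm] at hs3
    exact hs3 (mem_interior_iff_mem_nhds.2 hJ)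
  filter_upwards [(hKc.image hc).isClosed.isOpen_compl.mem_nhds hn] with z hz t ht
  refine ⟨round (t₀ - t), ?_⟩
  by_contra hcon
  apply hz
  refine ⟨t + round (t₀ - t), ⟨?_, fun h => hcon (interior_subset h)⟩, by rw [per_int hp, ht]⟩
  have := abs_le.1 (abs_sub_round (t₀ - t))
  constructor <;> linarith [this.1, this.2]

lemma local_def {γ : ℝ → ℂ} (hs : ContDiff ℝ (⊤ : ℕ∞) γ) (t₀ : ℝ) (h0 : deriv γ t₀ ≠ 0) :
    ∃ (f : ℂ → ℝ) (W : Set ℂ), IsOpen W ∧ γ t₀ ∈ W ∧ ContDiffOn ℝ (⊤ : ℕ∞) f W ∧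
      ∃ J ∈ 𝓝 t₀, ∀ t ∈ J, f (γ t) = 0 ∧ 0 < fderiv ℝ f (γ t) (I * deriv γ t) := by
  set c := deriv γ t₀ with hc
  let ζ : ℂ → ℂ := fun z => (z - γ t₀) / c
  have hζ : ContDiff ℝ (⊤ : ℕ∞) ζ := (contDiff_id.sub contDiff_const).div_const c
  have hre : ContDiff ℝ (⊤ : ℕ∞) (fun z => (ζ z).re) := Complex.reCLM.contDiff.comp hζ
  have him : ContDiff ℝ (⊤ : ℕ∞) (fun z => (ζ z).im) := Complex.imCLM.contDiff.comp hζ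
  let x : ℝ → ℝ := fun t => (ζ (γ t)).re
  have hx : ContDiff ℝ (⊤ : ℕ∞) x := hre.comp hs
  have hx0 : HasDerivAt x 1 t₀ := by
    have h1 : HasDerivAt γ c t₀ := (hs.differentiable (by simp) t₀).hasDerivAt
    have h2 : HasDerivAt (fun t => ζ (γ t)) (c / c) t₀ := (h1.sub_const _).div_const c
    rw [div_self h0] at h2
    have h3 := Complex.reCLM.hasFDerivAt.comp_hasDerivAt t₀ h2
    rw [Complex.reCLM_apply, one_re] at h3
    exact h3
  have hx1 : HasStrictDerivAt x 1 t₀ :=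
    hx.contDiffAt.hasStrictDerivAt' hx0 (by simp)
  let e : OpenPartialHomeomorph ℝ ℝ :=
    (hx1.hasStrictFDerivAt_equiv one_ne_zero).toOpenPartialHomeomorph x
  have hex : ∀ t, e t = x t := fun t => rfl
  have het : t₀ ∈ e.source :=
    (hx1.hasStrictFDerivAt_equiv one_ne_zero).mem_toOpenPartialHomeomorph_source
  have hcd : Continuous (deriv x) := hx.continuous_deriv (by simp)
  let T : Set ℝ := e.target ∩ e.symm ⁻¹' {t | deriv x t ≠ 0}
  have hT : IsOpen T := e.symm.isOpen_inter_preimage (isOpen_ne_fun hcd continuous_const)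
  have hτ : ContDiffOn ℝ (⊤ : ℕ∞) e.symm T := by
    intro y hy
    have h1 : HasDerivAt e (deriv x (e.symm y)) (e.symm y) :=
      (hx.differentiable (by simp) _).hasDerivAt
    exact (e.contDiffAt_symm_deriv hy.2 hy.1 h1 hx.contDiffAt).contDiffWithinAt
  let W : Set ℂ := (fun z => (ζ z).re) ⁻¹' T
  let f : ℂ → ℝ := fun z => (ζ z).im - (ζ (γ (e.symm (ζ z).re))).im
  have hW : IsOpen W := hT.preimage hre.continuous
  have hW0 : γ t₀ ∈ W := by
    refine ⟨e.map_source het, ?_⟩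
    change deriv x (e.symm (e t₀)) ≠ 0
    rw [e.left_inv het, hx0.deriv]
    exact one_ne_zero
  have hf : ContDiffOn ℝ (⊤ : ℕ∞) f W := by
    refine him.contDiffOn.sub ?_
    exact (him.comp hs).comp_contDiffOn (hτ.comp hre.contDiffOn (fun z hz => hz))
  refine ⟨f, W, hW, hW0, hf, ?_⟩
  have hpos : 0 < fderiv ℝ f (γ t₀) (I * deriv γ t₀) := by
    have hd : DifferentiableAt ℝ f (γ t₀) :=
      (hf.contDiffAt (hW.mem_nhds hW0)).differentiableAt (by simp)
    rw [← hd.lineDeriv_eq_fderiv, lineDeriv]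
    have h1 : (fun s : ℝ => f (γ t₀ + s • (I * deriv γ t₀))) =
        fun s => s - (ζ (γ (e.symm 0))).im := by
      funext s
      have h2 : ζ (γ t₀ + s • (I * deriv γ t₀)) = s * I := by
        simp only [ζ, real_smul, ← hc]
        field_simp
        ring
      simp only [f, h2]
      simp
    rw [h1]
    simp
  have hcont : ContinuousAt (fun t => fderiv ℝ f (γ t) (I * deriv γ t)) t₀ := by
    have h1 : ContinuousAt (fderiv ℝ f) (γ t₀) :=
      (hf.continuousOn_fderiv_of_isOpen hW (by simp)).continuousAt (hW.mem_nhds hW0)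
    have h2 : ContinuousAt (fun t => fderiv ℝ f (γ t)) t₀ :=
      ContinuousAt.comp (f := γ) h1 hs.continuous.continuousAt
    exact h2.clm_apply (continuousAt_const.mul (hs.continuous_deriv (by simp)).continuousAt)
  refine ⟨_, inter_mem (e.open_source.mem_nhds het) (hcont.eventually (lt_mem_nhds hpos)), ?_⟩
  rintro t ⟨ht1, ht2⟩
  refine ⟨?_, ht2⟩
  have : e.symm (ζ (γ t)).re = t := e.left_inv ht1
  simp only [f, this, sub_self]

lemma local_rho {γ : ℝ → ℂ} (hp : Function.Periodic γ 1) (hi : InjOn γ (Ico 0 1))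
    (hs : ContDiff ℝ (⊤ : ℕ∞) γ) (t₀ : ℝ) (h0 : deriv γ t₀ ≠ 0) :
    ∃ ρ : ℂ → ℝ, ContDiff ℝ (⊤ : ℕ∞) ρ ∧ (∀ t, ρ (γ t) = 0) ∧
      (∀ t, 0 ≤ fderiv ℝ ρ (γ t) (I * deriv γ t)) ∧
      0 < fderiv ℝ ρ (γ t₀) (I * deriv γ t₀) := by
  obtain ⟨f, W, hW, hW0, hf, J, hJ, hJf⟩ := local_def hs t₀ h0
  obtain ⟨χ, hχs, -, hχ, hχr, hχ1⟩ := exists_contDiff_tsupport_subset (n := ⊤)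
    (inter_mem (hW.mem_nhds hW0) (local_param hp hi hs.continuous t₀ hJ))
  have key : ∀ t, γ t ∈ tsupport χ → f (γ t) = 0 ∧
      fderiv ℝ (fun z => χ z * f z) (γ t) (I * deriv γ t)
        = χ (γ t) * fderiv ℝ f (γ t) (I * deriv γ t) ∧
      0 < fderiv ℝ f (γ t) (I * deriv γ t) := by
    intro t ht
    obtain ⟨m, hm⟩ := (hχs ht).2 t rfl
    have h1 := hJf _ hm
    rw [per_int hp, per_int (deriv_per hp)] at h1
    refine ⟨h1.1, ?_, h1.2⟩
    have hd : DifferentiableAt ℝ f (γ t) :=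
      (hf.contDiffAt (hW.mem_nhds (hχs ht).1)).differentiableAt (by simp)
    rw [fderiv_fun_mul (hχ.differentiable (by simp) _) hd]
    simp [h1.1]
  have key2 : ∀ t, γ t ∉ tsupport χ → fderiv ℝ (fun z => χ z * f z) (γ t) = 0 := by
    intro t ht
    have : (fun z => χ z * f z) =ᶠ[𝓝 (γ t)] fun _ => 0 := by
      filter_upwards [(isClosed_tsupport χ).isOpen_compl.mem_nhds ht] with w hw
      rw [image_eq_zero_of_notMem_tsupport hw, zero_mul]
    rw [this.fderiv_eq]; simp
  have hχ0 : ∀ z, 0 ≤ χ z := fun z => (hχr ⟨z, rfl⟩).1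
  refine ⟨fun z => χ z * f z, cutoff_mul hW hf hχ (hχs.trans inter_subset_left), ?_, ?_, ?_⟩
  · intro t
    by_cases ht : γ t ∈ tsupport χ
    · simp [(key t ht).1]
    · simp [image_eq_zero_of_notMem_tsupport ht]
  · intro t
    by_cases ht : γ t ∈ tsupport χ
    · rw [(key t ht).2.1]; exact mul_nonneg (hχ0 _) (key t ht).2.2.le
    · rw [key2 t ht]; simp
  · have ht : γ t₀ ∈ tsupport χ := subset_tsupport _ (by simp [hχ1])
    rw [(key t₀ ht).2.1, hχ1, one_mul]; exact (key t₀ ht).2.2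

lemma exists_defining {γ : ℝ → ℂ} (hp : Function.Periodic γ 1) (hi : InjOn γ (Ico 0 1))
    (hs : ContDiff ℝ (⊤ : ℕ∞) γ) (h0 : ∀ t, deriv γ t ≠ 0) :
    ∃ r : ℂ → ℝ, ContDiff ℝ (⊤ : ℕ∞) r ∧ HasCompactSupport r ∧
      ∀ q ∈ γ '' Icc 0 1, r q = 0 ∧ fderiv ℝ r q ≠ 0 := by
  choose ρ hρ hρ0 hρn hρp using fun t₀ => local_rho hp hi hs t₀ (h0 t₀)
  have hcont : ∀ t₀, Continuous (fun t => fderiv ℝ (ρ t₀) (γ t) (I * deriv γ t)) := fun t₀ =>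
    (((hρ t₀).continuous_fderiv (by simp)).comp hs.continuous).clm_apply
      (continuous_const.mul (hs.continuous_deriv (by simp)))
  obtain ⟨F, -, hF⟩ := (isCompact_Icc (a := (0 : ℝ)) (b := 1)).elim_nhds_subcover
    (fun t₀ => {t | 0 < fderiv ℝ (ρ t₀) (γ t) (I * deriv γ t)})
    (fun t₀ _ => (hcont t₀).continuousAt.eventually (lt_mem_nhds (hρp t₀)))
  have hsum : ContDiff ℝ (⊤ : ℕ∞) (fun z => ∑ t₀ ∈ F, ρ t₀ z) := ContDiff.sum fun t _ => hρ t
  obtain ⟨r, hr, hrc, hre⟩ := cutoff_ext isOpen_univ (isCompact_Icc.image hs.continuous)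
    (subset_univ (γ '' Icc 0 1)) hsum.contDiffOn
  refine ⟨r, hr, hrc, ?_⟩
  rintro q ⟨t, ht, rfl⟩
  have hev := hre (γ t) ⟨t, ht, rfl⟩
  refine ⟨?_, ?_⟩
  · rw [hev.self_of_nhds]
    exact Finset.sum_eq_zero fun t₀ _ => hρ0 t₀ t
  · intro hzero
    have h1 : fderiv ℝ r (γ t) = fderiv ℝ (fun z => ∑ t₀ ∈ F, ρ t₀ z) (γ t) :=
      Filter.EventuallyEq.fderiv_eq hev
    rw [h1, fderiv_fun_sum fun t₀ _ => (hρ t₀).differentiable (by simp) _] at hzero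
    have h2 := congrArg (fun l : ℂ →L[ℝ] ℝ => l (I * deriv γ t)) hzero
    simp only [sum_apply, zero_apply] at h2
    obtain ⟨t₀, ht₀, hpos⟩ := mem_iUnion₂.1 (hF ht)
    have h3 := (Finset.sum_eq_zero_iff_of_nonneg fun t₀ _ => hρn t₀ t).1 h2 t₀ ht₀
    exact (ne_of_gt hpos) h3

lemma grad_ne {l : ℂ →L[ℝ] ℝ} (hl : l ≠ 0) : l 1 ^ 2 + l I ^ 2 ≠ 0 := by
  intro h
  apply hl
  have h1 : l 1 = 0 := by nlinarith [sq_nonneg (l 1), sq_nonneg (l I)]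
  have h2 : l I = 0 := by nlinarith [sq_nonneg (l 1), sq_nonneg (l I)]
  ext z
  have : z = z.re • (1 : ℂ) + z.im • I := by simp
  rw [this, map_add, map_smul, map_smul, h1, h2]
  simp


/-- **Prescribing the Laplacian to infinite order with homogeneous Cauchy data.**
Let `Ω` be a bounded Jordan domain with `C^∞` smooth boundary and let `U` be a
real-valued `C^∞` function on a neighborhood of `Ω̄`.  Then there exists a real-valued
`C^∞` function `φ` on `ℂ` such that `φ` vanishes identically on `bΩ`, the (outward)
normal derivative `∂φ/∂n` vanishes identically on `bΩ`, and `Δφ` agrees with `U` to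
infinite order on `bΩ`: all partial derivatives of every order of `Δφ − U` vanish at
every point of `bΩ`.  (With the counterclockwise parametrization `γ`, the outward unit
normal at `γ(t)` is `−i·γ'(t)/|γ'(t)|`.) -/
theorem laplacian_infinite_order_matching
    (Ω : Set ℂ) (γ : ℝ → ℂ) (hΩ : SmoothJordanDomain Ω γ)
    (U : ℂ → ℝ) (V : Set ℂ) (hV : IsOpen V) (hΩV : closure Ω ⊆ V)
    (hU : ContDiffOn ℝ (⊤ : ℕ∞) U V) :
    ∃ φ : ℂ → ℝ, ContDiff ℝ (⊤ : ℕ∞) φ ∧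
      EqOn φ 0 (frontier Ω) ∧
      (∀ t : ℝ, fderiv ℝ φ (γ t) (-I * deriv γ t / (‖deriv γ t‖ : ℂ)) = 0) ∧
      (∀ n : ℕ, ∀ q ∈ frontier Ω,
        iteratedFDerivWithin ℝ n (fun z => laplacianR φ z - U z) V q = 0) := by
  set K : Set ℂ := γ '' Icc 0 1 with hK
  have hKc : IsCompact K := isCompact_Icc.image hΩ.smooth.continuous
  have hKV : K ⊆ V := by
    rw [hK, hΩ.image]; exact frontier_subset_closure.trans hΩV
  have hγK : ∀ t, γ t ∈ K := fun t => by
    refine ⟨Int.fract t, ⟨Int.fract_nonneg _, (Int.fract_lt_one _).le⟩, ?_⟩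
    have := per_int hΩ.periodic t (-⌊t⌋)
    rw [← this]; congr 1
    rw [Int.fract]; push_cast; ring
  rw [← hΩ.image, ← hK]
  obtain ⟨r, hr, hrc, hrK⟩ := exists_defining hΩ.periodic hΩ.injOn hΩ.smooth hΩ.derivNe
  obtain ⟨u, hu, -, huK⟩ := cutoff_ext hV hKc hKV hU
  have hG : ContDiff ℝ (⊤ : ℕ∞) (fun z => (fderiv ℝ r z 1) ^ 2 + (fderiv ℝ r z I) ^ 2) :=
    ((contDiff_d hr 1).pow 2).add ((contDiff_d hr I).pow 2)
  have hWo : IsOpen {z | (fderiv ℝ r z 1) ^ 2 + (fderiv ℝ r z I) ^ 2 ≠ 0} :=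
    isOpen_ne_fun hG.continuous continuous_const
  have hKW : K ⊆ {z | (fderiv ℝ r z 1) ^ 2 + (fderiv ℝ r z I) ^ 2 ≠ 0} :=
    fun q hq => grad_ne (hrK q hq).2
  obtain ⟨g, hg, hgc, hgK⟩ := cutoff_ext hWo hKc hKW (hG.contDiffOn.inv fun z hz => hz)
  have hgK' : ∀ q ∈ K, ∀ᶠ z in 𝓝 q,
      g z * ((fderiv ℝ r z 1) ^ 2 + (fderiv ℝ r z I) ^ 2) = 1 := by
    intro q hq
    filter_upwards [hgK q hq, hWo.mem_nhds (hKW hq)] with z h1 h2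
    rw [h1]; exact inv_mul_cancel₀ h2
  have hhs := contDiff_hseq hr hg hu
  choose b hb hbq hbb using fun k => borel_term hr hrc (contDiff_aOf hg (hhs k) k)
    (HasCompactSupport.mul_right hgc) k (ε := (1 / 2 : ℝ) ^ k) (by positivity)
  have htail := flat_tail hb hbb
  have hsumm : ∀ z, Summable fun k => b k z := fun z =>
    Summable.of_norm_bounded summable_geometric_two fun k => by
      simpa using hbb k 0 (by omega) z
  have hsplit : ∀ N, (fun z => ∑' k, b k z) =
      fun z => ∑ k ∈ Finset.range N, b k z + ∑' k, b (k + N) z := fun N => by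
    funext z; exact ((hsumm z).sum_add_tsum_nat_add N).symm
  have hpart : ∀ N, ContDiff ℝ (⊤ : ℕ∞) (fun z => ∑ k ∈ Finset.range N, b k z) :=
    fun N => ContDiff.sum fun k _ => hb k
  have hφ : ContDiff ℝ (⊤ : ℕ∞) (fun z => ∑' k, b k z) := by
    rw [contDiff_infty]
    intro N
    rw [hsplit N]
    exact ((hpart N).of_le (natcast_le_top' N)).add
      ((htail N).1.of_le (by exact_mod_cast Nat.le_succ N))
  have htailS : ∀ N, ContDiff ℝ (⊤ : ℕ∞) (fun z => ∑' k, b (k + N) z) := fun N => by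
    have e : (fun z => ∑' k, b (k + N) z) =
        fun z => (∑' k, b k z) - ∑ k ∈ Finset.range N, b k z := by
      funext z
      have := congrFun (hsplit N) z
      rw [this]; ring
    rw [e]
    exact hφ.sub (hpart N)
  have hbf : ∀ q ∈ K, ∀ k, FlatAt (k + 2) (b k) q := fun q hq k =>
    (flat_pow_mul hr (contDiff_aOf hg (hhs k) k) (hrK q hq).1 (k + 2)).congr
      (hbq k q (hrK q hq).1)
  have hφf : ∀ q ∈ K, FlatAt 2 (fun z => ∑' k, b k z) q := fun q hq => by
    simpa using (htail 0).2 q (hbf q hq)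
  refine ⟨fun z => ∑' k, b k z, hφ, ?_, ?_, ?_⟩
  · intro q hq
    have h1 := hφf q hq 0 (by omega)
    have h2 := congrArg norm h1
    rw [norm_iteratedFDeriv_zero, norm_zero, norm_eq_zero] at h2
    exact h2
  · intro t
    have h1 := hφf _ (hγK t) 1 (by omega)
    have h2 := congrArg norm h1
    rw [← zero_add 1, ← norm_iteratedFDeriv_fderiv, norm_iteratedFDeriv_zero, norm_zero,
      norm_eq_zero] at h2
    rw [h2]; rfl
  · intro n q hq
    rw [iteratedFDerivWithin_of_isOpen n hV (hKV hq)]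
    have hflat : FlatAt (n + 1) (fun z => r z ^ (n + 1) * hseq r g u (n + 1) z
        + laplacianR (fun z => ∑' k, b (k + (n + 1)) z) z) q :=
      FlatAt.add ((hr.pow _).mul (hhs _)) (contDiff_lap (htailS _))
        (flat_pow_mul hr (hhs _) (hrK q hq).1 _)
        (FlatAt.lap (htailS _) ((htail (n + 1)).2 q (hbf q hq)))
    refine hflat.congr ?_ n (by omega)
    filter_upwards [lap_partial hr hg hu q (hgK' q hq) b hb (fun k => hbq k q (hrK q hq).1) (n + 1),
      huK q hq] with z h1 h2
    rw [hsplit (n + 1), lap_add (hpart _) (htailS _), h1, h2]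
    ring
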